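/- Let A and B be finite sets of integers with |A| ≥ 5, |B| ≥ 2, B ⊆ A, and |A +̂ B| = |A| + |B| - 3. Then A = B and A is an arithmetic progression: there exist integers τ and d with d ≠ 0 such that A = {τ + i·d : i = 0, 1, ..., |A| - 1}. -/

import Mathlib

/-- The restricted sumset of two finite sets of integers:
`A +̂ B = {a + b : a ∈ A, b ∈ B, a ≠ b}`. -/
def restrictedSumset (A B : Finset ℤ) : Finset ℤ :=
  ((A ×ˢ B).filter fun p => p.1 ≠ p.2).image fun p => p.1 + p.2

theorem mem_rs {A B : Finset ℤ} {x : ℤ} :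
    x ∈ restrictedSumset A B ↔ ∃ a ∈ A, ∃ b ∈ B, a ≠ b ∧ a + b = x := by
  unfold restrictedSumset
  simp only [Finset.mem_image, Finset.mem_filter, Finset.mem_product, Prod.exists]
  constructor
  · rintro ⟨a, b, ⟨⟨ha, hb⟩, h⟩, e⟩
    exact ⟨a, ha, b, hb, h, e⟩
  · rintro ⟨a, ha, b, hb, h, e⟩
    exact ⟨a, b, ⟨⟨ha, hb⟩, h⟩, e⟩

theorem rs_mono {A B C D : Finset ℤ} (h : A ⊆ C) (h' : B ⊆ D) :
    restrictedSumset A B ⊆ restrictedSumset C D := by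
  intro x hx
  rw [mem_rs] at *
  obtain ⟨a, ha, b, hb, h1, h2⟩ := hx
  exact ⟨a, h ha, b, h' hb, h1, h2⟩

theorem top_two (T : Finset ℤ) (hT : 2 ≤ T.card) :
    ∃ x ∈ T, ∃ y ∈ T, x < y ∧ ∀ z ∈ restrictedSumset T T, z ≤ x + y := by
  have h1 : T.Nonempty := Finset.card_pos.1 (by omega)
  have hm := T.max'_mem h1
  have hc := Finset.card_erase_of_mem hm
  have h2 : (T.erase (T.max' h1)).Nonempty := Finset.card_pos.1 (by omega)
  have hx := Finset.max'_mem _ h2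
  have hx' := Finset.mem_erase.1 hx
  have hle := T.le_max' _ hx'.2
  refine ⟨_, hx'.2, _, hm, lt_of_le_of_ne hle hx'.1, ?_⟩
  intro z hz
  obtain ⟨a, ha, b, hb, hab, rfl⟩ := mem_rs.1 hz
  have ha1 := T.le_max' _ ha
  have hb1 := T.le_max' _ hb
  by_cases h : a = T.max' h1
  · have := Finset.le_max' _ b (Finset.mem_erase.2 ⟨fun e => hab (h.trans e.symm), hb⟩)
    omega
  · have := Finset.le_max' _ a (Finset.mem_erase.2 ⟨h, ha⟩)
    omega

/-- adding a new maximum gives two new sums -/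
theorem two_new (T S R : Finset ℤ) (M : ℤ) (hT : 2 ≤ T.card) (hM : ∀ x ∈ T, x < M)
    (hS : S ⊆ restrictedSumset T T) (hSR : S ⊆ R) (hR : ∀ x ∈ T, M + x ∈ R) :
    S.card + 2 ≤ R.card := by
  obtain ⟨x, hx, y, hy, hxy, hz⟩ := top_two T hT
  have hyM := hM y hy
  have hxM := hM x hx
  have n1 : M + x ∉ S := fun h => by have := hz _ (hS h); omega
  have n2 : M + y ∉ insert (M + x) S := fun h => by
    rcases Finset.mem_insert.1 h with h | h
    · omega
    · have := hz _ (hS h); omega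
  have : insert (M + y) (insert (M + x) S) ⊆ R := by
    intro w hw
    simp only [Finset.mem_insert] at hw
    rcases hw with rfl | rfl | hw
    · exact hR _ hy
    · exact hR _ hx
    · exact hSR hw
  have := Finset.card_le_card this
  rw [Finset.card_insert_of_notMem n2, Finset.card_insert_of_notMem n1] at this
  omega

theorem self_step (s : Finset ℤ) (M : ℤ) (hs : 2 ≤ s.card) (hM : ∀ x ∈ s, x < M) :
    (restrictedSumset s s).card + 2 ≤ (restrictedSumset (insert M s) (insert M s)).card := by
  apply two_new s _ _ M hs hM (Finset.Subset.refl _)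
    (rs_mono (Finset.subset_insert _ _) (Finset.subset_insert _ _))
  intro x hx
  exact mem_rs.2 ⟨M, Finset.mem_insert_self _ _, x, Finset.mem_insert_of_mem hx,
    (hM x hx).ne', rfl⟩

theorem self_bound (A : Finset ℤ) : 2 * A.card ≤ (restrictedSumset A A).card + 3 := by
  induction A using Finset.induction_on_max with
  | empty => simp
  | insert M s hM ih =>
    have hn : M ∉ s := fun h => lt_irrefl _ (hM M h)
    rw [Finset.card_insert_of_notMem hn]
    by_cases h2 : 2 ≤ s.card
    · have := self_step s M h2 hM
      omega
    · by_cases h1 : s.card = 1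
      · obtain ⟨a, rfl⟩ := Finset.card_eq_one.1 h1
        have : M + a ∈ restrictedSumset (insert M {a}) (insert M {a}) :=
          mem_rs.2 ⟨M, by simp, a, by simp, (hM a (by simp)).ne', rfl⟩
        have := Finset.card_pos.2 ⟨_, this⟩
        simp only [Finset.card_singleton]
        omega
      · omega

theorem single_bound (A : Finset ℤ) (b : ℤ) (hb : b ∈ A) :
    A.card ≤ (restrictedSumset A {b}).card + 1 := by
  have : (A.erase b).image (fun x => x + b) ⊆ restrictedSumset A {b} := by
    intro x hx
    simp only [Finset.mem_image, Finset.mem_erase] at hx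
    obtain ⟨a, ⟨h1, h2⟩, rfl⟩ := hx
    exact mem_rs.2 ⟨a, h2, b, by simp, h1, rfl⟩
  have := Finset.card_le_card this
  rw [Finset.card_image_of_injective _ (add_left_injective b), Finset.card_erase_of_mem hb] at this
  omega

theorem proper_bound (A : Finset ℤ) : ∀ B ⊆ A, B ≠ A → B.Nonempty →
    A.card + B.card ≤ (restrictedSumset A B).card + 2 := by
  induction A using Finset.induction_on_max with
  | empty =>
    intro B hB h _
    exact absurd (Finset.subset_empty.1 hB) h
  | insert M s hM ih =>
    intro B hB hne hBn
    have hn : M ∉ s := fun h => lt_irrefl _ (hM M h)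
    by_cases hMB : M ∈ B
    · by_cases h1 : B.card = 1
      · obtain ⟨b, rfl⟩ := Finset.card_eq_one.1 h1
        have := single_bound (insert M s) b (hB (by simp))
        omega
      · have hpos := Finset.card_pos.2 hBn
        have hc := Finset.card_erase_of_mem hMB
        have hsub : B.erase M ⊆ s := by
          intro x hx
          rw [Finset.mem_erase] at hx
          exact (Finset.mem_insert.1 (hB hx.2)).resolve_left hx.1
        have hne' : B.erase M ≠ s := by
          intro h
          apply hne
          rw [← h, Finset.insert_erase hMB]
        have hi := ih _ hsub hne' (Finset.card_pos.1 (by omega))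
        have hlt : (B.erase M).card < s.card :=
          Finset.card_lt_card (lt_of_le_of_ne hsub hne')
        have := two_new s (restrictedSumset s (B.erase M)) (restrictedSumset (insert M s) B) M
          (by omega) hM (rs_mono (Finset.Subset.refl _) hsub)
          (rs_mono (Finset.subset_insert _ _) (Finset.erase_subset _ _)) (by
            intro x hx
            exact mem_rs.2 ⟨x, Finset.mem_insert_of_mem hx, M, hMB, (hM x hx).ne, add_comm _ _⟩)
        rw [Finset.card_insert_of_notMem hn]
        omega
    · have hsub : B ⊆ s := by
        intro x hx
        exact (Finset.mem_insert.1 (hB hx)).resolve_left (fun h => hMB (h ▸ hx))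
      rw [Finset.card_insert_of_notMem hn]
      by_cases hBs : B = s
      · subst hBs
        by_cases h2 : 2 ≤ B.card
        · have h3 := self_bound B
          have := two_new B (restrictedSumset B B) (restrictedSumset (insert M B) B) M h2 hM
            (Finset.Subset.refl _) (rs_mono (Finset.subset_insert _ _) (Finset.Subset.refl _)) (by
              intro x hx
              exact mem_rs.2 ⟨M, Finset.mem_insert_self _ _, x, hx, (hM x hx).ne', rfl⟩)
          omega
        · obtain ⟨b, hb⟩ := hBn
          have : M + b ∈ restrictedSumset (insert M B) B :=
            mem_rs.2 ⟨M, Finset.mem_insert_self _ _, b, hb, (hM b hb).ne', rfl⟩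
          have := Finset.card_pos.2 ⟨_, this⟩
          omega
      · have hi := ih B hsub hBs hBn
        have hm := B.max'_mem hBn
        have hnew : M + B.max' hBn ∉ restrictedSumset s B := by
          intro h
          obtain ⟨a, ha, b, hb, _, e⟩ := mem_rs.1 h
          have := hM a ha
          have := B.le_max' b hb
          omega
        have hss : insert (M + B.max' hBn) (restrictedSumset s B) ⊆
            restrictedSumset (insert M s) B := by
          apply Finset.insert_subset
          · exact mem_rs.2 ⟨M, Finset.mem_insert_self _ _, _, hm, (hM _ (hsub hm)).ne', rfl⟩
          · exact rs_mono (Finset.subset_insert _ _) (Finset.Subset.refl _)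
        have := Finset.card_le_card hss
        rw [Finset.card_insert_of_notMem hnew] at this
        omega

theorem base_five (A : Finset ℤ) (hA : A.card = 5) (hR : (restrictedSumset A A).card ≤ 7) :
    ∃ τ d : ℤ, 0 < d ∧ A = (Finset.range 5).image fun i : ℕ => τ + (i : ℤ) * d := by
  let f := A.orderEmbOfFin hA
  have hf : ∀ i, f i ∈ A := fun i => A.orderEmbOfFin_mem hA i
  have hr := A.range_orderEmbOfFin hA
  have m01 : f 0 < f 1 := f.strictMono (by decide)
  have m12 : f 1 < f 2 := f.strictMono (by decide)
  have m23 : f 2 < f 3 := f.strictMono (by decide)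
  have m34 : f 3 < f 4 := f.strictMono (by decide)
  have hmem : ∀ i j, i ≠ j → f i + f j ∈ restrictedSumset A A := fun i j h =>
    mem_rs.2 ⟨_, hf i, _, hf j, fun e => h (f.injective e), rfl⟩
  have q01 := hmem 0 1 (by decide)
  have q02 := hmem 0 2 (by decide)
  have q12 := hmem 1 2 (by decide)
  have q13 := hmem 1 3 (by decide)
  have q23 := hmem 2 3 (by decide)
  have q24 := hmem 2 4 (by decide)
  have q34 := hmem 3 4 (by decide)
  have q03 := hmem 0 3 (by decide)
  have q14 := hmem 1 4 (by decide)
  have q04 := hmem 0 4 (by decide)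
  have hAf : ∀ x, x ∈ A ↔ x = f 0 ∨ x = f 1 ∨ x = f 2 ∨ x = f 3 ∨ x = f 4 := by
    intro x
    have : x ∈ (A : Set ℤ) ↔ x ∈ Set.range f := by rw [hr]
    rw [Finset.mem_coe] at this
    rw [this, Set.mem_range]
    constructor
    · rintro ⟨i, rfl⟩
      fin_cases i <;> simp
    · rintro (h | h | h | h | h) <;> exact ⟨_, h.symm⟩
  generalize f 0 = a0 at *
  generalize f 1 = a1 at *
  generalize f 2 = a2 at *
  generalize f 3 = a3 at *
  generalize f 4 = a4 at *
  clear hmem hf hr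
  let C : Finset ℤ := {a0+a1, a0+a2, a1+a2, a1+a3, a2+a3, a2+a4, a3+a4}
  have hC : C.card = 7 := by
    simp only [C]
    repeat rw [Finset.card_insert_of_notMem (by
      simp only [Finset.mem_insert, Finset.mem_singleton]; omega)]
    simp
  have hCR : C ⊆ restrictedSumset A A := by
    intro x hx
    simp only [C, Finset.mem_insert, Finset.mem_singleton] at hx
    rcases hx with rfl | rfl | rfl | rfl | rfl | rfl | rfl <;> assumption
  have hE := Finset.eq_of_subset_of_card_le hCR (by omega)
  rw [← hE] at q03 q14 q04
  simp only [C, Finset.mem_insert, Finset.mem_singleton] at q03 q14 q04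
  have e1 : a0 + a3 = a1 + a2 := by omega
  have e2 : a1 + a4 = a2 + a3 := by omega
  have e3 : a0 + a4 = a1 + a3 := by omega
  refine ⟨a0, a1 - a0, by omega, ?_⟩
  ext x
  rw [hAf]
  simp [Finset.range_add_one]
  omega

theorem ap_of_card (A : Finset ℤ) : 5 ≤ A.card → (restrictedSumset A A).card + 3 ≤ 2 * A.card →
    ∃ τ d : ℤ, 0 < d ∧ A = (Finset.range A.card).image fun i : ℕ => τ + (i : ℤ) * d := by
  induction A using Finset.induction_on_max with
  | empty => simp
  | insert M s hM ih =>
    intro h5 hR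
    have hn : M ∉ s := fun h => lt_irrefl _ (hM M h)
    by_cases h : (insert M s).card = 5
    · rw [h]
      exact base_five _ h (by omega)
    have hc := Finset.card_insert_of_notMem hn
    have hst := self_step s M (by omega) hM
    have hb := self_bound s
    obtain ⟨τ, d, hd, hs⟩ := ih (by omega) (by omega)
    rw [hc]
    obtain ⟨k, hk⟩ : ∃ k, s.card = k + 3 := ⟨s.card - 3, by omega⟩
    rw [hk] at hs
    have hms : ∀ x, x ∈ s ↔ ∃ i : ℕ, i < k + 3 ∧ τ + (i : ℤ) * d = x := by
      intro x
      rw [hs]; simp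
    have mem : ∀ i : ℕ, i < k + 3 → τ + (i : ℤ) * d ∈ s := fun i hi => (hms _).2 ⟨i, hi, rfl⟩
    have hMk := hM _ (mem (k + 2) (by omega))
    have key : M + (τ + (k : ℤ) * d) ∈ restrictedSumset s s := by
      by_contra hcon
      have hmax : ∀ z ∈ restrictedSumset s s, z ≤ 2 * τ + (2 * k + 3) * d := by
        intro z hz
        obtain ⟨a, ha, b, hb, hab, rfl⟩ := mem_rs.1 hz
        obtain ⟨i, hi, rfl⟩ := (hms _).1 ha
        obtain ⟨j, hj, rfl⟩ := (hms _).1 hb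
        have hij : i ≠ j := fun e => hab (by rw [e])
        have : (i : ℤ) + j ≤ 2 * k + 3 := by omega
        nlinarith
      push_cast at hMk
      have n1 : M + (τ + ((k + 1 : ℕ) : ℤ) * d) ∉
          insert (M + (τ + (k : ℤ) * d)) (restrictedSumset s s) := by
        intro h
        rcases Finset.mem_insert.1 h with h | h
        · push_cast at h; nlinarith
        · have := hmax _ h; push_cast at this; nlinarith
      have n2 : M + (τ + ((k + 2 : ℕ) : ℤ) * d) ∉ insert (M + (τ + ((k + 1 : ℕ) : ℤ) * d))
          (insert (M + (τ + (k : ℤ) * d)) (restrictedSumset s s)) := by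
        intro h
        rcases Finset.mem_insert.1 h with h | h
        · push_cast at h; nlinarith
        rcases Finset.mem_insert.1 h with h | h
        · push_cast at h; nlinarith
        · have := hmax _ h; push_cast at this; nlinarith
      have hin : ∀ i : ℕ, i < k + 3 → M + (τ + (i : ℤ) * d) ∈
          restrictedSumset (insert M s) (insert M s) := fun i hi =>
        mem_rs.2 ⟨M, Finset.mem_insert_self _ _, _, Finset.mem_insert_of_mem (mem i hi),
          (hM _ (mem i hi)).ne', rfl⟩
      have hsub := Finset.card_le_card
        (Finset.insert_subset (hin (k + 2) (by omega)) (Finset.insert_subset (hin (k + 1) (by omega))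
          (Finset.insert_subset (hin k (by omega))
            (rs_mono (Finset.subset_insert M s) (Finset.subset_insert M s)))))
      rw [Finset.card_insert_of_notMem n2, Finset.card_insert_of_notMem n1,
        Finset.card_insert_of_notMem hcon] at hsub
      omega
    have hMeq : M = τ + ((k + 3 : ℕ) : ℤ) * d := by
      obtain ⟨a, ha, b, hb, hab, e⟩ := mem_rs.1 key
      obtain ⟨i, hi, rfl⟩ := (hms _).1 ha
      obtain ⟨j, hj, rfl⟩ := (hms _).1 hb
      have hij : i ≠ j := fun e => hab (by rw [e])
      push_cast at hMk ⊢
      have hlt : (2 * k + 2 : ℤ) < i + j := by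
        by_contra hc
        push Not at hc
        nlinarith
      have hs : (i : ℤ) + j = 2 * k + 3 := by omega
      linear_combination (-1 : ℤ) * e + d * hs
    refine ⟨τ, d, hd, ?_⟩
    rw [hk, Finset.range_add_one, Finset.image_insert, ← hs, ← hMeq]

theorem stmt_7 (A B : Finset ℤ) (hA : 5 ≤ A.card) (hB : 2 ≤ B.card)
    (hBA : B ⊆ A)
    (hcrit : (restrictedSumset A B).card = A.card + B.card - 3) :
    A = B ∧ ∃ τ d : ℤ, d ≠ 0 ∧
      A = (Finset.range A.card).image fun i : ℕ => τ + (i : ℤ) * d := by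
  have hAB : A = B := by
    by_contra h
    have := proper_bound A B hBA (fun e => h e.symm) (Finset.card_pos.1 (by omega))
    omega
  refine ⟨hAB, ?_⟩
  subst hAB
  obtain ⟨τ, d, hd, h⟩ := ap_of_card A hA (by omega)
  exact ⟨τ, d, hd.ne', h⟩
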